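/- Let h : ℝ²×ℝ → ℂ be a Schwartz function and Q(t,ξ) = (t/(4π)) ∫_{S²} h((ξ,0)+tη) dS(η) its planar photoacoustic data. Then for every ε > 0, ω ∈ ℝ and σ ∈ ℝ², the following iterated integral is absolutely convergent and satisfies ∫₀^∞ e^{(iω−ε)t} ( ∫_{ℝ²} Q(t,ξ) e^{i σ·ξ} dξ ) dt = √(2π) · ∫_ℝ 𝓕h(σ,k) / ( ‖σ‖² + k² − (ω + iε)² ) dk, where the denominator never vanishes for ε > 0. -/

import Mathlib

open MeasureTheory Real Complex
open scoped RealInnerProductSpace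

/-- Embedding of `ℝ² × ℝ` into `ℝ³` (Euclidean). -/
noncomputable def emb (ξ : EuclideanSpace ℝ (Fin 2)) (r : ℝ) : EuclideanSpace ℝ (Fin 3) :=
  (EuclideanSpace.equiv (Fin 3) ℝ).symm ![ξ 0, ξ 1, r]

/-- Planar photoacoustic data `Q(t,ξ) = (t/(4π)) ∫_{S²} h((ξ,0)+tη) dS(η)`,
where `dS` is the surface measure on the unit sphere of `ℝ³`. -/
noncomputable def Q (h : EuclideanSpace ℝ (Fin 3) → ℂ) (t : ℝ)
    (ξ : EuclideanSpace ℝ (Fin 2)) : ℂ :=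
  ((t / (4 * π) : ℝ) : ℂ) * ∫ η : Metric.sphere (0 : EuclideanSpace ℝ (Fin 3)) 1,
    h (emb ξ 0 + t • (η : EuclideanSpace ℝ (Fin 3)))
    ∂((volume : Measure (EuclideanSpace ℝ (Fin 3))).toSphere)

/-- Fourier transform of `h : ℝ³ → ℂ` written in the coordinates `(σ, ϱ) ∈ ℝ² × ℝ`:
`𝓕h(σ,ϱ) = (2π)^{−3/2} ∫_{ℝ³} h(x) e^{i(σ·x₁₂ + ϱ x₃)} dx`. -/
noncomputable def FTh (h : EuclideanSpace ℝ (Fin 3) → ℂ)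
    (σ : EuclideanSpace ℝ (Fin 2)) (ϱ : ℝ) : ℂ :=
  (((2 * π : ℝ) ^ (-(3 : ℝ) / 2) : ℝ) : ℂ) *
    ∫ x : EuclideanSpace ℝ (Fin 3),
      h x * Complex.exp (Complex.I * ((σ 0 * x 0 + σ 1 * x 1 + ϱ * x 2 : ℝ) : ℂ))

abbrev E2 := EuclideanSpace ℝ (Fin 2)
abbrev E3 := EuclideanSpace ℝ (Fin 3)

lemma emb_apply0 (ξ : E2) (r : ℝ) : emb ξ r 0 = ξ 0 := rfl
lemma emb_apply1 (ξ : E2) (r : ℝ) : emb ξ r 1 = ξ 1 := rfl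
lemma emb_apply2 (ξ : E2) (r : ℝ) : emb ξ r 2 = r := rfl

noncomputable def embE : E2 × ℝ ≃ᵐ E3 :=
  (MeasurableEquiv.prodComm.trans
    (MeasurableEquiv.prodCongr (MeasurableEquiv.refl ℝ) (MeasurableEquiv.toLp 2 (Fin 2 → ℝ)).symm)).trans
   ((MeasurableEquiv.piFinSuccAbove (fun _ : Fin 3 => ℝ) (Fin.last 2)).symm.trans
    (MeasurableEquiv.toLp 2 (Fin 3 → ℝ)))

lemma embE_apply (p : E2 × ℝ) : embE p = emb p.1 p.2 := by
  ext i
  fin_cases i <;> rfl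

lemma embE_mp : MeasurePreserving embE (volume.prod volume) volume := by
  have h1 : MeasurePreserving (MeasurableEquiv.prodComm (α := E2) (β := ℝ)) (volume.prod volume)
      (volume.prod volume) := Measure.measurePreserving_swap
  have h2 : MeasurePreserving (MeasurableEquiv.prodCongr (MeasurableEquiv.refl ℝ)
      (MeasurableEquiv.toLp 2 (Fin 2 → ℝ)).symm) (volume.prod volume) (volume.prod volume) :=
    (MeasurePreserving.id volume).prod
      (EuclideanSpace.volume_preserving_symm_measurableEquiv_toLp (Fin 2))
  have h3 := (volume_preserving_piFinSuccAbove (fun _ : Fin 3 => ℝ) (Fin.last 2)).symm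
  have h4 := (EuclideanSpace.volume_preserving_symm_measurableEquiv_toLp (Fin 3)).symm
  exact (h4.comp h3).comp (h2.comp h1)

lemma emb_norm (ξ : E2) (z : ℝ) : ‖emb ξ z‖ = √(‖ξ‖ ^ 2 + z ^ 2) := by
  rw [EuclideanSpace.norm_eq, EuclideanSpace.norm_eq, Real.sq_sqrt (by positivity)]
  simp [Fin.sum_univ_succ, emb, add_assoc]

/-- polar coordinates -/
lemma polar (F : E3 → ℂ) (hF : Integrable F) :
    IntegrableOn (fun t : ℝ => ((t ^ 2 : ℝ) : ℂ) *
      ∫ η : Metric.sphere (0 : E3) 1, F (t • (η : E3)) ∂(volume : Measure E3).toSphere) (Set.Ioi 0) ∧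
    ∫ x, F x = ∫ t in Set.Ioi (0 : ℝ), ((t ^ 2 : ℝ) : ℂ) *
      ∫ η : Metric.sphere (0 : E3) 1, F (t • (η : E3)) ∂(volume : Measure E3).toSphere := by
  have hd : Module.finrank ℝ E3 - 1 = 2 := by simp
  have mp := (volume : Measure E3).measurePreserving_homeomorphUnitSphereProd
  rw [hd] at mp
  let G : Metric.sphere (0 : E3) 1 × Set.Ioi (0 : ℝ) → ℂ := fun p => F ((p.2 : ℝ) • (p.1 : E3))
  have hG : ∀ x : ({0}ᶜ : Set E3), G (homeomorphUnitSphereProd E3 x) = F x := by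
    intro x
    have : (homeomorphUnitSphereProd E3).symm (homeomorphUnitSphereProd E3 x) = x := by simp
    have h2 := congrArg Subtype.val this
    rw [homeomorphUnitSphereProd_symm_apply_coe] at h2
    simp only [G, h2]
  have hFG : Integrable G ((volume : Measure E3).toSphere.prod (.volumeIoiPow 2)) := by
    rw [← mp.integrable_comp_emb (Homeomorph.measurableEmbedding _)]
    have : (G ∘ (homeomorphUnitSphereProd E3)) = F ∘ Subtype.val := by
      ext x; exact hG x
    rw [this, ← integrableOn_iff_comap_subtypeVal (by measurability)]
    exact hF.integrableOn
  have hintF : ∫ x, F x = ∫ p, G p ∂((volume : Measure E3).toSphere.prod (.volumeIoiPow 2)) := by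
    rw [← mp.integral_comp (Homeomorph.measurableEmbedding _)]
    simp only [hG]
    rw [integral_subtype_comap (measurableSet_singleton _).compl fun x ↦ F x,
        restrict_compl_singleton]
  have hI := hFG.integral_prod_right
  have hsm : ∀ t ∈ Set.Ioi (0 : ℝ), ∀ z : ℂ, Real.toNNReal (t ^ 2) • z = ((t ^ 2 : ℝ) : ℂ) * z := by
    intro t ht z
    rw [NNReal.smul_def, Real.coe_toNNReal _ (by positivity)]
    simp
  constructor
  · rw [Measure.volumeIoiPow] at hI
    simp only [ENNReal.ofReal] at hI
    rw [integrable_withDensity_iff_integrable_smul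
      ((measurable_subtype_coe.pow_const _).real_toNNReal)] at hI
    rw [integrableOn_iff_comap_subtypeVal measurableSet_Ioi]
    refine hI.congr (.of_forall fun t => ?_)
    simp only [Function.comp_def, G]
    exact hsm t t.2 _
  · rw [hintF, integral_prod_symm _ hFG]
    simp only [Measure.volumeIoiPow, ENNReal.ofReal]
    rw [integral_withDensity_eq_integral_smul ((measurable_subtype_coe.pow_const _).real_toNNReal),
      ← integral_subtype_comap measurableSet_Ioi]
    refine integral_congr_ae (.of_forall fun t => ?_)
    exact hsm t t.2 _

/-- Yukawa kernel -/
noncomputable def Yk (s : ℂ) (r : ℝ) : ℂ := Complex.exp (-s * r) / ((4 * π * r : ℝ) : ℂ)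

lemma Yk_int (s : ℂ) (hs : 0 < s.re) : Integrable (fun x : E3 => Yk s ‖x‖) := by
  rw [integrable_fun_norm_addHaar (volume : Measure E3) (f := Yk s)]
  have hd : Module.finrank ℝ E3 - 1 = 2 := by simp
  rw [hd]
  have h1 : IntegrableOn (fun r : ℝ => r ^ (1:ℝ) * Real.exp (-s.re * r)) (Set.Ioi 0) :=
    integrableOn_rpow_mul_exp_neg_mul_rpow (p := 1) (s := 1) (by norm_num) (by norm_num) hs |>.congr_fun
      (fun x hx => by simp) measurableSet_Ioi
  refine (h1.const_mul (1 / (4 * π))).mono' ?_ ?_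
  · apply Measurable.aestronglyMeasurable
    unfold Yk
    fun_prop
  · filter_upwards [ae_restrict_mem measurableSet_Ioi] with r hr
    have hr : 0 < r := hr
    have : ‖Yk s r‖ = Real.exp (-s.re * r) / (4 * π * r) := by
      rw [Yk, norm_div, Complex.norm_exp, Complex.norm_real, Real.norm_of_nonneg (by positivity)]
      simp
    rw [norm_smul, this, Real.norm_of_nonneg (by positivity), Real.rpow_one]
    apply le_of_eq
    field_simp

lemma Yk_radial (s : ℂ) (hs : 0 < s.re) (z : ℝ) (hz : z ≠ 0)
    (hi : Integrable (fun ξ : E2 => Yk s (√(‖ξ‖ ^ 2 + z ^ 2)))) :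
    ∫ ξ : E2, Yk s (√(‖ξ‖ ^ 2 + z ^ 2)) = Complex.exp (-s * |z|) / (2 * s) := by
  have hs0 : s ≠ 0 := by rintro rfl; simp at hs
  have hd : Module.finrank ℝ E2 = 2 := by simp
  have hi2 := (integrable_fun_norm_addHaar (volume : Measure E2)
    (f := fun y => Yk s (√(y ^ 2 + z ^ 2)))).1 hi
  rw [integral_fun_norm_addHaar (volume : Measure E2) (fun y => Yk s (√(y ^ 2 + z ^ 2)))]
  rw [hd] at hi2 ⊢
  have hv : (volume : Measure E2).real (Metric.ball 0 1) = π := by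
    simp [Measure.real, EuclideanSpace.volume_ball_fin_two, Real.pi_pos.le]
  have key : ∫ y in Set.Ioi (0:ℝ), y ^ (2 - 1) • Yk s (√(y ^ 2 + z ^ 2)) =
      0 - (-(Complex.exp (-s * (√(0 ^ 2 + z ^ 2) : ℝ)) / (4 * π * s))) := by
    apply integral_Ioi_of_hasDerivAt_of_tendsto'
      (f := fun y : ℝ => -(Complex.exp (-s * (√(y ^ 2 + z ^ 2) : ℝ)) / (4 * π * s))) _ hi2
    · have : Filter.Tendsto (fun y : ℝ => √(y ^ 2 + z ^ 2)) Filter.atTop Filter.atTop := by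
        refine Filter.tendsto_atTop_mono (f := fun y => y) (fun y => ?_) Filter.tendsto_id
        exact Real.le_sqrt_of_sq_le (by nlinarith [sq_nonneg z])
      rw [tendsto_zero_iff_norm_tendsto_zero]
      have h2 : Filter.Tendsto (fun y : ℝ => Real.exp (-(s.re * √(y ^ 2 + z ^ 2))) / ‖(4 * π * s : ℂ)‖)
        Filter.atTop (nhds (0 / ‖(4 * π * s : ℂ)‖)) :=
        (Real.tendsto_exp_neg_atTop_nhds_zero.comp (this.const_mul_atTop hs)).div_const _
      rw [zero_div] at h2
      refine h2.congr fun y => ?_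
      rw [norm_neg, norm_div, Complex.norm_exp]
      simp
    · intro y hy
      have hpos : 0 < y ^ 2 + z ^ 2 := by positivity
      have h1 : HasDerivAt (fun y : ℝ => √(y ^ 2 + z ^ 2)) (y / √(y ^ 2 + z ^ 2)) y := by
        have := ((hasDerivAt_pow 2 y).add_const (z ^ 2)).sqrt hpos.ne'
        convert this using 1
        have := (Real.sqrt_pos.2 hpos).ne'
        push_cast
        field_simp
      have h2 := ((((h1.ofReal_comp).const_mul (-s)).cexp).div_const (4 * π * s)).neg
      refine h2.congr_deriv ?_
      have : (√(y ^ 2 + z ^ 2) : ℂ) ≠ 0 := by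
        exact_mod_cast (Real.sqrt_pos.2 hpos).ne'
      have hpi : (π : ℂ) ≠ 0 := by exact_mod_cast Real.pi_ne_zero
      simp [Yk]
      field_simp
  rw [key, hv]
  have hpi : (π : ℂ) ≠ 0 := by exact_mod_cast Real.pi_ne_zero
  simp [Real.sqrt_sq_eq_abs]
  field_simp
  ring

lemma exp_abs_FT (s : ℂ) (hs : 0 < s.re) (K : ℝ) :
    ∫ z : ℝ, Complex.exp (-s * |z|) * Complex.exp (-(Complex.I * (K * z : ℝ))) =
      2 * s / (K ^ 2 + s ^ 2) := by
  have e1 : ∀ z ∈ Set.Ioi (0:ℝ), Complex.exp (-s * |z|) * Complex.exp (-(Complex.I * (K * z : ℝ)))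
      = Complex.exp ((-s - Complex.I * K) * z) := by
    intro z hz
    rw [abs_of_pos hz, ← Complex.exp_add]; congr 1; push_cast; ring
  have e2 : ∀ z ∈ Set.Iic (0:ℝ), Complex.exp (-s * |z|) * Complex.exp (-(Complex.I * (K * z : ℝ)))
      = Complex.exp ((s - Complex.I * K) * z) := by
    intro z hz
    rw [abs_of_nonpos hz, ← Complex.exp_add]; congr 1; push_cast; ring
  have r1 : (-s - Complex.I * K).re < 0 := by simpa using hs
  have r2 : 0 < (s - Complex.I * K).re := by simpa using hs
  have i1 := (integrableOn_exp_mul_complex_Ioi r1 0).congr_fun (fun z hz => (e1 z hz).symm)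
    measurableSet_Ioi
  have i2 := (integrableOn_exp_mul_complex_Iic r2 0).congr_fun (fun z hz => (e2 z hz).symm)
    measurableSet_Iic
  rw [← intervalIntegral.integral_Iic_add_Ioi i2 i1, setIntegral_congr_fun measurableSet_Ioi e1,
    setIntegral_congr_fun measurableSet_Iic e2, integral_exp_mul_complex_Ioi r1,
    integral_exp_mul_complex_Iic r2]
  have n1 : -s - Complex.I * K ≠ 0 := by intro h; rw [h] at r1; simp at r1
  have n2 : s - Complex.I * K ≠ 0 := by intro h; rw [h] at r2; simp at r2
  have n3 : (K ^ 2 + s ^ 2 : ℂ) ≠ 0 := by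
    have : (K ^ 2 + s ^ 2 : ℂ) = -((-s - Complex.I * K) * (s - Complex.I * K)) := by
      linear_combination ((K:ℂ)^2) * Complex.I_sq
    rw [this]; exact neg_ne_zero.2 (mul_ne_zero n1 n2)
  simp only [Complex.ofReal_zero, mul_zero, Complex.exp_zero]
  rw [div_add_div _ _ n2 n1, div_eq_div_iff (mul_ne_zero n2 n1) n3]
  linear_combination (-2 * s * (K:ℂ)^2) * Complex.I_sq

lemma Yk_FT_axis (s : ℂ) (hs : 0 < s.re) (K : ℝ) :
    ∫ x : E3, Yk s ‖x‖ * Complex.exp (-(Complex.I * ((K * x 2 : ℝ) : ℂ))) =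
      1 / (K ^ 2 + s ^ 2) := by
  have hs0 : s ≠ 0 := by rintro rfl; simp at hs
  have hbase := Yk_int s hs
  have hI : Integrable (fun x : E3 => Yk s ‖x‖ * Complex.exp (-(Complex.I * ((K * x 2 : ℝ) : ℂ)))) := by
    refine hbase.mul_bdd (c := 1) ?_ (.of_forall fun x => ?_)
    · apply Continuous.aestronglyMeasurable; fun_prop
    · rw [Complex.norm_exp]; simp
  rw [← embE_mp.integral_comp embE.measurableEmbedding]
  rw [← embE_mp.integrable_comp_emb embE.measurableEmbedding] at hI hbase
  simp only [Function.comp_def, embE_apply, emb_norm, emb_apply2] at hI hbase ⊢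
  rw [integral_prod_symm _ hI]
  have hae : ∀ᵐ z : ℝ, ∫ ξ : E2, Yk s √(‖ξ‖ ^ 2 + z ^ 2) * Complex.exp (-(Complex.I * ((K * z : ℝ) : ℂ)))
      = (1 / (2 * s)) * (Complex.exp (-s * |z|) * Complex.exp (-(Complex.I * (K * z : ℝ)))) := by
    filter_upwards [hbase.prod_left_ae, Measure.ae_ne volume (0:ℝ)] with z hz hz0
    rw [integral_mul_const, Yk_radial s hs z hz0 hz]
    field_simp
  rw [integral_congr_ae hae, integral_const_mul, exp_abs_FT s hs]
  field_simp

lemma Yk_FT (s : ℂ) (hs : 0 < s.re) (κ : E3) :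
    ∫ x : E3, Yk s ‖x‖ * Complex.exp (-(Complex.I * ((⟪κ, x⟫ : ℝ) : ℂ))) =
      1 / (‖κ‖ ^ 2 + s ^ 2) := by
  let e : E3 := EuclideanSpace.single 2 ‖κ‖
  have he : ‖e‖ = ‖κ‖ := by simp [e]
  let R := Submodule.reflection (ℝ ∙ (e - κ))ᗮ
  have hR : R e = κ := Submodule.reflection_sub he
  have mp : MeasurePreserving R volume volume := R.measurePreserving
  rw [← mp.integral_comp R.toHomeomorph.measurableEmbedding, ← Yk_FT_axis s hs ‖κ‖]
  congr 1
  ext x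
  have : (⟪κ, R x⟫ : ℝ) = ‖κ‖ * x 2 := by
    rw [← hR, LinearIsometryEquiv.inner_map_map, hR]
    simp [e, EuclideanSpace.inner_single_left]
  rw [this, LinearIsometryEquiv.norm_map]

lemma schwartz_decay (h : SchwartzMap E3 ℂ) :
    ∃ C : ℝ, 0 ≤ C ∧ ∀ x, ‖h x‖ ≤ C * (1 + ‖x‖) ^ (-3 : ℝ) := by
  refine ⟨2 ^ 3 * ((Finset.Iic ((3, 0) : ℕ × ℕ)).sup fun m => SchwartzMap.seminorm ℝ m.1 m.2) h,
    by positivity, fun x => ?_⟩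
  have := SchwartzMap.one_add_le_sup_seminorm_apply (𝕜 := ℝ) (m := (3, 0)) (k := 3) (n := 0)
    le_rfl le_rfl h x
  rw [norm_iteratedFDeriv_zero] at this
  rw [Real.rpow_neg (by positivity), ← div_eq_mul_inv, le_div_iff₀ (by positivity)]
  have e : (1 + ‖x‖) ^ (3 : ℝ) = (1 + ‖x‖) ^ 3 := by exact_mod_cast Real.rpow_natCast (1 + ‖x‖) 3
  rw [e, mul_comm]
  exact this

lemma le_emb_norm_left (ξ : E2) (z : ℝ) : ‖ξ‖ ≤ ‖emb ξ z‖ := by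
  rw [emb_norm]; exact Real.le_sqrt_of_sq_le (by nlinarith [sq_nonneg z])

lemma le_emb_norm_right (ξ : E2) (z : ℝ) : |z| ≤ ‖emb ξ z‖ := by
  rw [emb_norm]; exact Real.le_sqrt_of_sq_le (by rw [sq_abs]; nlinarith [sq_nonneg ‖ξ‖])

lemma emb_continuous : Continuous (fun p : E2 × ℝ => emb p.1 p.2) := by
  unfold emb
  refine (EuclideanSpace.equiv (Fin 3) ℝ).symm.continuous.comp ?_
  refine continuous_pi fun i => ?_
  fin_cases i <;> simp <;> fun_prop

@[fun_prop]
lemma emb_continuous' {X : Type*} [TopologicalSpace X] (f : X → E2) (g : X → ℝ)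
    (hf : Continuous f) (hg : Continuous g) : Continuous (fun x => emb (f x) (g x)) :=
  emb_continuous.comp (hf.prodMk hg)

lemma decay_mono {C a b : ℝ} (hC : 0 ≤ C) (ha : 0 ≤ a) (hab : a ≤ b) :
    C * (1 + b) ^ (-3 : ℝ) ≤ C * (1 + a) ^ (-3 : ℝ) := by
  refine mul_le_mul_of_nonneg_left ?_ hC
  exact Real.rpow_le_rpow_of_nonpos (by positivity) (by linarith) (by norm_num)

lemma schwartz_bound (h : SchwartzMap E3 ℂ) :
    ∃ B : E2 → ℝ, Integrable B ∧ (∀ ξ z, ‖h (emb ξ z)‖ ≤ B ξ) := by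
  obtain ⟨C, hC, hb⟩ := schwartz_decay h
  refine ⟨fun ξ => C * (1 + ‖ξ‖) ^ (-3 : ℝ), ?_, fun ξ z => ?_⟩
  · exact (integrable_one_add_norm (by simp; norm_num)).const_mul C
  · exact (hb _).trans (decay_mono hC (norm_nonneg _) (le_emb_norm_left ξ z))

/-- partial Fourier transform -/
noncomputable def PF (h : E3 → ℂ) (σ : E2) (z : ℝ) : ℂ :=
  ∫ ξ : E2, h (emb ξ z) * Complex.exp (Complex.I * ((⟪σ, ξ⟫ : ℝ) : ℂ))

lemma norm_exp_I (r : ℝ) : ‖Complex.exp (Complex.I * (r : ℂ))‖ = 1 := by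
  rw [mul_comm]; exact Complex.norm_exp_ofReal_mul_I r

lemma norm_exp_negI (r : ℝ) : ‖Complex.exp (-(Complex.I * (r : ℂ)))‖ = 1 := by
  have := norm_exp_I (-r)
  simpa using this

lemma PF_continuous (h : SchwartzMap E3 ℂ) (σ : E2) : Continuous (PF h σ) := by
  obtain ⟨B, hB, hb⟩ := schwartz_bound h
  have hc := h.continuous
  refine continuous_of_dominated (bound := B) (fun z => ?_) (fun z => .of_forall fun ξ => ?_) hB
    (.of_forall fun ξ => ?_)
  · apply Continuous.aestronglyMeasurable
    fun_prop
  · rw [norm_mul, norm_exp_I, mul_one]; exact hb ξ z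
  · fun_prop

lemma PF_bdd (h : SchwartzMap E3 ℂ) (σ : E2) : ∃ M, ∀ z, ‖PF h σ z‖ ≤ M := by
  obtain ⟨B, hB, hb⟩ := schwartz_bound h
  refine ⟨∫ ξ, B ξ, fun z => norm_integral_le_of_norm_le hB (.of_forall fun ξ => ?_)⟩
  rw [norm_mul, norm_exp_I, mul_one]; exact hb ξ z

lemma inner_emb (σ : E2) (k : ℝ) (x : E3) :
    (⟪emb σ k, x⟫ : ℝ) = σ 0 * x 0 + σ 1 * x 1 + k * x 2 := by
  simp [PiLp.inner_apply, Fin.sum_univ_succ, emb]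
  ring

lemma inner2 (σ ξ : E2) : (⟪σ, ξ⟫ : ℝ) = σ 0 * ξ 0 + σ 1 * ξ 1 := by
  simp [PiLp.inner_apply, Fin.sum_univ_succ]
  ring

lemma aux_int (h : SchwartzMap E3 ℂ) (σ : E2) (k : ℝ) :
    Integrable (fun p : E2 × ℝ => h (emb p.1 p.2) *
      Complex.exp (Complex.I * ((⟪σ, p.1⟫ : ℝ) : ℂ)) * Complex.exp (Complex.I * ((k * p.2 : ℝ) : ℂ))) 
      (volume.prod volume) := by
  have h0 := h.integrable (μ := volume)
  rw [← embE_mp.integrable_comp_emb embE.measurableEmbedding] at h0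
  simp only [Function.comp_def, embE_apply] at h0
  refine Integrable.mul_bdd (c := 1) (Integrable.mul_bdd (c := 1) h0 ?_ ?_) ?_ ?_
  · apply Continuous.aestronglyMeasurable
    fun_prop
  · exact .of_forall fun p => (norm_exp_I _).le
  · apply Continuous.aestronglyMeasurable
    fun_prop
  · exact .of_forall fun p => (norm_exp_I _).le

lemma PF_integrable (h : SchwartzMap E3 ℂ) (σ : E2) : Integrable (PF h σ) := by
  have := (aux_int h σ 0).integral_prod_right
  simpa [PF] using! this

lemma FTh_eq_PF (h : SchwartzMap E3 ℂ) (σ : E2) (k : ℝ) :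
    FTh h σ k = (((2 * π : ℝ) ^ (-(3 : ℝ) / 2) : ℝ) : ℂ) *
      ∫ z : ℝ, PF h σ z * Complex.exp (Complex.I * ((k * z : ℝ) : ℂ)) := by
  unfold FTh
  congr 1
  rw [← embE_mp.integral_comp embE.measurableEmbedding]
  simp only [embE_apply, emb_apply0, emb_apply1, emb_apply2]
  have e : ∀ p : E2 × ℝ, h (emb p.1 p.2) * Complex.exp (Complex.I *
      ((σ 0 * p.1 0 + σ 1 * p.1 1 + k * p.2 : ℝ) : ℂ)) = h (emb p.1 p.2) *
      Complex.exp (Complex.I * ((⟪σ, p.1⟫ : ℝ) : ℂ)) * Complex.exp (Complex.I * ((k * p.2 : ℝ) : ℂ)) := by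
    intro p
    rw [mul_assoc, ← Complex.exp_add, inner2]
    congr 2
    push_cast; ring
  simp only [e]
  rw [integral_prod_symm _ (aux_int h σ k)]
  simp only [integral_mul_const, PF]

open FourierTransform in
lemma FTh_eq_fourier (h : SchwartzMap E3 ℂ) (σ : E2) (k : ℝ) :
    FTh h σ k = (((2 * π : ℝ) ^ (-(3 : ℝ) / 2) : ℝ) : ℂ) *
      (𝓕 h : SchwartzMap E3 ℂ) ((-(2 * π)⁻¹ : ℝ) • emb σ k) := by
  unfold FTh
  congr 1
  rw [SchwartzMap.fourier_coe, Real.fourier_eq']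
  congr 1
  ext x
  rw [inner_smul_right, real_inner_comm, inner_emb, smul_eq_mul, mul_comm]
  congr 2
  have hpi : (π : ℂ) ≠ 0 := by exact_mod_cast Real.pi_ne_zero
  push_cast
  field_simp

open FourierTransform in
lemma FTh_continuous (h : SchwartzMap E3 ℂ) (σ : E2) : Continuous (FTh h σ) := by
  have : FTh h σ = _ := funext (FTh_eq_fourier h σ)
  rw [this]
  have := (𝓕 h : SchwartzMap E3 ℂ).continuous
  fun_prop

open FourierTransform in
lemma FTh_integrable (h : SchwartzMap E3 ℂ) (σ : E2) : Integrable (FTh h σ) := by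
  obtain ⟨C, hC, hb⟩ := schwartz_decay (𝓕 h : SchwartzMap E3 ℂ)
  have i0 : Integrable (fun k : ℝ => (1 + ‖k‖) ^ (-3 : ℝ)) :=
    integrable_one_add_norm (by simp)
  have i1 := i0.comp_mul_left' (R := (2 * π)⁻¹) (by positivity)
  refine ((i1.const_mul C).const_mul ((2 * π) ^ (-(3 : ℝ) / 2))).mono'
    (FTh_continuous h σ).aestronglyMeasurable (.of_forall fun k => ?_)
  rw [FTh_eq_fourier, norm_mul, Complex.norm_real, Real.norm_of_nonneg (by positivity)]
  refine mul_le_mul_of_nonneg_left ?_ (by positivity)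
  refine (hb _).trans (decay_mono hC (norm_nonneg _) ?_)
  rw [norm_smul, norm_neg, norm_mul]
  exact mul_le_mul_of_nonneg_left (le_emb_norm_right σ k) (norm_nonneg _)

open FourierTransform in
lemma PF_inv (h : SchwartzMap E3 ℂ) (σ : E2) (z : ℝ) :
    PF h σ z = ((Real.sqrt (2 * π) : ℝ) : ℂ) *
      ∫ k : ℝ, FTh h σ k * Complex.exp (-(Complex.I * ((k * z : ℝ) : ℂ))) := by
  set c : ℂ := (((2 * π : ℝ) ^ (-(3 : ℝ) / 2) : ℝ) : ℂ) with hc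
  have hc0 : c ≠ 0 := by
    rw [hc]; exact_mod_cast (by positivity : (0:ℝ) < (2 * π : ℝ) ^ (-(3 : ℝ) / 2)).ne'
  have hF : ∀ w : ℝ, 𝓕 (PF h σ) w = c⁻¹ * FTh h σ (-(2 * π) * w) := by
    intro w
    rw [FTh_eq_PF, ← hc, inv_mul_cancel_left₀ hc0, Real.fourier_eq']
    congr 1
    ext x
    rw [smul_eq_mul, mul_comm]
    congr 2
    simp
    ring
  have hFi : Integrable (𝓕 (PF h σ)) := by
    have : 𝓕 (PF h σ) = _ := funext hF
    rw [this]
    exact ((FTh_integrable h σ).comp_mul_left' (R := -(2 * π))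
      (neg_ne_zero.2 (by positivity))).const_mul _
  have inv := (PF_integrable h σ).fourierInv_fourier_eq hFi (PF_continuous h σ).continuousAt (v := z)
  rw [← inv, Real.fourierInv_eq']
  have e : ∀ v : ℝ, Complex.exp (((2 * π * (⟪v, z⟫ : ℝ) : ℝ) : ℂ) * Complex.I) • 𝓕 (PF h σ) v =
      c⁻¹ * (fun k : ℝ => FTh h σ k * Complex.exp (-(Complex.I * ((k * z : ℝ) : ℂ)))) (-(2 * π) * v) := by
    intro v
    simp only [smul_eq_mul, hF v]
    rw [mul_comm, mul_assoc]
    congr 3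
    simp
    ring
  simp only [e]
  rw [integral_const_mul, Measure.integral_comp_mul_left
    (fun k : ℝ => FTh h σ k * Complex.exp (-(Complex.I * ((k * z : ℝ) : ℂ))))]
  rw [Complex.real_smul, ← mul_assoc]
  congr 1
  rw [hc, ← Complex.ofReal_inv, ← Complex.ofReal_mul]
  congr 1
  rw [abs_of_neg (by rw [inv_neg, neg_lt_zero]; positivity), inv_neg, neg_neg, neg_div,
    Real.rpow_neg (by positivity), inv_inv, Real.sqrt_eq_rpow,
    show (3 / 2 : ℝ) = 1 / 2 + 1 by norm_num, Real.rpow_add_one (by positivity)]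
  field_simp

/-- projection -/
noncomputable def prj (x : E3) : E2 := (EuclideanSpace.equiv (Fin 2) ℝ).symm ![x 0, x 1]

lemma emb_shift (ξ : E2) (y : E3) : emb ξ 0 + y = emb (ξ + prj y) (y 2) := by
  ext i
  fin_cases i <;> simp [emb, prj]

lemma inner_prj (σ : E2) (y : E3) : (⟪σ, prj y⟫ : ℝ) = ⟪emb σ 0, y⟫ := by
  rw [inner_emb, inner2]
  simp [prj]

/-- Fibre integral. -/
lemma fibre (h : SchwartzMap E3 ℂ) (σ : E2) (y : E3) :
    ∫ ξ : E2, h (emb ξ 0 + y) * Complex.exp (Complex.I * ((⟪σ, ξ⟫ : ℝ) : ℂ)) =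
      Complex.exp (-(Complex.I * ((⟪emb σ 0, y⟫ : ℝ) : ℂ))) * PF h σ (y 2) := by
  have e : ∀ ξ : E2, h (emb ξ 0 + y) * Complex.exp (Complex.I * ((⟪σ, ξ⟫ : ℝ) : ℂ)) =
      (fun ζ : E2 => Complex.exp (-(Complex.I * ((⟪emb σ 0, y⟫ : ℝ) : ℂ))) *
        (h (emb ζ (y 2)) * Complex.exp (Complex.I * ((⟪σ, ζ⟫ : ℝ) : ℂ)))) (ξ + prj y) := by
    intro ξ
    simp only [emb_shift]
    rw [mul_left_comm, ← Complex.exp_add, inner_add_right, inner_prj]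
    congr 2
    push_cast; ring
  simp only [e]
  rw [integral_add_right_eq_self (fun ζ : E2 => Complex.exp (-(Complex.I * ((⟪emb σ 0, y⟫ : ℝ) : ℂ))) *
        (h (emb ζ (y 2)) * Complex.exp (Complex.I * ((⟪σ, ζ⟫ : ℝ) : ℂ)))) (prj y), integral_const_mul]
  rfl

lemma prod_int (h : SchwartzMap E3 ℂ) (σ : E2) (t : ℝ) :
    Integrable (fun p : E2 × Metric.sphere (0 : E3) 1 => h (emb p.1 0 + t • (p.2 : E3)) *
      Complex.exp (Complex.I * ((⟪σ, p.1⟫ : ℝ) : ℂ)))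
      ((volume : Measure E2).prod (volume : Measure E3).toSphere) := by
  obtain ⟨B, hB, hb⟩ := schwartz_bound h
  have hc := h.continuous
  have hm : AEStronglyMeasurable (fun p : E2 × Metric.sphere (0 : E3) 1 =>
      h (emb p.1 0 + t • (p.2 : E3)) * Complex.exp (Complex.I * ((⟪σ, p.1⟫ : ℝ) : ℂ)))
      ((volume : Measure E2).prod (volume : Measure E3).toSphere) := by
    apply Continuous.aestronglyMeasurable
    fun_prop
  have hbd : ∀ (y : E3) (ξ : E2), ‖h (emb ξ 0 + y) * Complex.exp (Complex.I * ((⟪σ, ξ⟫ : ℝ) : ℂ))‖ ≤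
      B (ξ + prj y) := by
    intro y ξ
    rw [norm_mul, norm_exp_I, mul_one, emb_shift]
    exact hb _ _
  have hfi : ∀ y : E3, Integrable (fun ξ : E2 =>
      h (emb ξ 0 + y) * Complex.exp (Complex.I * ((⟪σ, ξ⟫ : ℝ) : ℂ))) := by
    intro y
    refine (hB.comp_add_right (prj y)).mono' ?_ (Filter.Eventually.of_forall fun ξ => hbd y ξ)
    apply Continuous.aestronglyMeasurable
    fun_prop
  rw [integrable_prod_iff' hm]
  refine ⟨Filter.Eventually.of_forall fun η => hfi (t • (η : E3)), ?_⟩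
  have hm2 : AEStronglyMeasurable (fun η : Metric.sphere (0 : E3) 1 => ∫ ξ : E2,
      ‖h (emb ξ 0 + t • (η : E3)) * Complex.exp (Complex.I * ((⟪σ, ξ⟫ : ℝ) : ℂ))‖)
      (volume : Measure E3).toSphere :=
    AEStronglyMeasurable.integral_prod_right' (f := fun q : Metric.sphere (0 : E3) 1 × E2 =>
      ‖h (emb q.2 0 + t • (q.1 : E3)) * Complex.exp (Complex.I * ((⟪σ, q.2⟫ : ℝ) : ℂ))‖)
      (Continuous.aestronglyMeasurable (by fun_prop))
  refine Integrable.of_bound (C := ∫ ξ, B ξ) hm2 (.of_forall fun η => ?_)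
  rw [Real.norm_of_nonneg (integral_nonneg fun _ => norm_nonneg _),
    ← integral_add_right_eq_self B (prj (t • (η : E3)))]
  exact integral_mono (hfi (t • (η : E3))).norm (hB.comp_add_right (prj (t • (η : E3))))
    (fun ξ => hbd (t • (η : E3)) ξ)

lemma Q_mul (h : E3 → ℂ) (σ : E2) (t : ℝ) (ξ : E2) :
    Q h t ξ * Complex.exp (Complex.I * ((⟪σ, ξ⟫ : ℝ) : ℂ)) = ((t / (4 * π) : ℝ) : ℂ) *
      ∫ η : Metric.sphere (0 : E3) 1, h (emb ξ 0 + t • (η : E3)) *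
        Complex.exp (Complex.I * ((⟪σ, ξ⟫ : ℝ) : ℂ)) ∂(volume : Measure E3).toSphere := by
  rw [Q, integral_mul_const, mul_assoc]

lemma Q_integrable (h : SchwartzMap E3 ℂ) (σ : E2) (t : ℝ) :
    Integrable (fun ξ : E2 => Q h t ξ * Complex.exp (Complex.I * ((⟪σ, ξ⟫ : ℝ) : ℂ))) := by
  simp only [Q_mul]
  exact (prod_int h σ t).integral_prod_left.const_mul _

lemma Q_integral (h : SchwartzMap E3 ℂ) (σ : E2) (t : ℝ) :
    ∫ ξ : E2, Q h t ξ * Complex.exp (Complex.I * ((⟪σ, ξ⟫ : ℝ) : ℂ)) =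
      ((t / (4 * π) : ℝ) : ℂ) * ∫ η : Metric.sphere (0 : E3) 1,
        Complex.exp (-(Complex.I * ((⟪emb σ 0, t • (η : E3)⟫ : ℝ) : ℂ))) *
          PF h σ ((t • (η : E3)) 2) ∂(volume : Measure E3).toSphere := by
  simp only [Q_mul]
  rw [integral_const_mul, integral_integral_swap (prod_int h σ t)]
  simp only [fibre]

lemma denom_ne (ε : ℝ) (hε : 0 < ε) (ω : ℝ) (a : ℝ) (ha : 0 ≤ a) :
    (a : ℂ) - ((ω : ℂ) + Complex.I * (ε : ℂ)) ^ 2 ≠ 0 := by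
  intro h
  have h1 := congrArg Complex.re h
  have h2 := congrArg Complex.im h
  simp [pow_two] at h1 h2
  have : ω = 0 := by
    have : ω * ε = 0 := by linarith
    rcases mul_eq_zero.1 this with h | h
    · exact h
    · exact absurd h hε.ne'
  subst this
  nlinarith

theorem stmt15 (h : SchwartzMap (EuclideanSpace ℝ (Fin 3)) ℂ)
    (ε : ℝ) (hε : 0 < ε) (ω : ℝ) (σ : EuclideanSpace ℝ (Fin 2)) :
    (∀ t : ℝ, Integrable (fun ξ : EuclideanSpace ℝ (Fin 2) =>
        Q (⇑h) t ξ * Complex.exp (Complex.I * ((⟪σ, ξ⟫ : ℝ) : ℂ)))) ∧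
    IntegrableOn (fun t : ℝ =>
        Complex.exp ((Complex.I * (ω : ℂ) - (ε : ℂ)) * (t : ℂ)) *
          ∫ ξ : EuclideanSpace ℝ (Fin 2),
            Q (⇑h) t ξ * Complex.exp (Complex.I * ((⟪σ, ξ⟫ : ℝ) : ℂ)))
      (Set.Ioi (0 : ℝ)) ∧
    (∀ k : ℝ, ((‖σ‖ ^ 2 + k ^ 2 : ℝ) : ℂ) - ((ω : ℂ) + Complex.I * (ε : ℂ)) ^ 2 ≠ 0) ∧
    (∫ t in Set.Ioi (0 : ℝ),
        Complex.exp ((Complex.I * (ω : ℂ) - (ε : ℂ)) * (t : ℂ)) *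
          ∫ ξ : EuclideanSpace ℝ (Fin 2),
            Q (⇑h) t ξ * Complex.exp (Complex.I * ((⟪σ, ξ⟫ : ℝ) : ℂ)))
      = ((Real.sqrt (2 * π) : ℝ) : ℂ) *
          ∫ k : ℝ, FTh (⇑h) σ k /
            (((‖σ‖ ^ 2 + k ^ 2 : ℝ) : ℂ) - ((ω : ℂ) + Complex.I * (ε : ℂ)) ^ 2) := by
  set s : ℂ := (ε : ℂ) - Complex.I * ω with hsdef
  have hs : 0 < s.re := by simpa [hsdef] using hε
  let F : E3 → ℂ := fun x => Yk s ‖x‖ *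
    (Complex.exp (-(Complex.I * ((⟪emb σ 0, x⟫ : ℝ) : ℂ))) * PF h σ (x 2))
  have hPc := PF_continuous h σ
  obtain ⟨M, hM⟩ := PF_bdd h σ
  have hF : Integrable F := by
    refine (Yk_int s hs).mul_bdd (c := M) ?_ (.of_forall fun x => ?_)
    · apply Continuous.aestronglyMeasurable
      fun_prop
    · rw [norm_mul, norm_exp_negI, one_mul]; exact hM _
  obtain ⟨hp1, hp2⟩ := polar F hF
  have hpt : ∀ t ∈ Set.Ioi (0:ℝ), ((t ^ 2 : ℝ) : ℂ) *
      ∫ η : Metric.sphere (0 : E3) 1, F (t • (η : E3)) ∂(volume : Measure E3).toSphere =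
      Complex.exp ((Complex.I * (ω : ℂ) - (ε : ℂ)) * (t : ℂ)) *
          ∫ ξ : EuclideanSpace ℝ (Fin 2),
            Q (⇑h) t ξ * Complex.exp (Complex.I * ((⟪σ, ξ⟫ : ℝ) : ℂ)) := by
    intro t ht
    have ht : 0 < t := ht
    have hn : ∀ η : Metric.sphere (0 : E3) 1, ‖t • (η : E3)‖ = t := by
      intro η
      rw [norm_smul, norm_eq_of_mem_sphere, mul_one, Real.norm_of_nonneg ht.le]
    rw [Q_integral]
    simp only [F, hn]
    rw [integral_const_mul, ← mul_assoc, ← mul_assoc]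
    congr 1
    have htc : (t : ℂ) ≠ 0 := by exact_mod_cast ht.ne'
    have hpi : (π : ℂ) ≠ 0 := by exact_mod_cast Real.pi_ne_zero
    have : (Complex.I * (ω : ℂ) - (ε : ℂ)) = -s := by rw [hsdef]; ring
    rw [this, Yk]
    push_cast
    field_simp
  refine ⟨Q_integrable h σ, hp1.congr_fun hpt measurableSet_Ioi,
    fun k => denom_ne ε hε ω _ (by positivity), ?_⟩
  rw [← setIntegral_congr_fun measurableSet_Ioi hpt, ← hp2]
  have hprod : Integrable (fun p : E3 × ℝ => (Yk s ‖p.1‖ * FTh h σ p.2) *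
      Complex.exp (-(Complex.I * ((⟪emb σ p.2, p.1⟫ : ℝ) : ℂ)))) (volume.prod volume) := by
    refine ((Yk_int s hs).mul_prod (FTh_integrable h σ)).mul_bdd (c := 1) ?_
      (.of_forall fun p => (norm_exp_negI _).le)
    apply Continuous.aestronglyMeasurable
    fun_prop
  have hFx : ∀ x, F x = ((Real.sqrt (2 * π) : ℝ) : ℂ) * ∫ k : ℝ, (Yk s ‖x‖ * FTh h σ k) *
      Complex.exp (-(Complex.I * ((⟪emb σ k, x⟫ : ℝ) : ℂ))) := by
    intro x
    simp only [F]
    rw [PF_inv, mul_left_comm _ ((Real.sqrt (2 * π) : ℝ) : ℂ),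
      mul_left_comm _ ((Real.sqrt (2 * π) : ℝ) : ℂ), ← integral_const_mul, ← integral_const_mul]
    congr 2
    ext k
    rw [mul_left_comm _ (FTh h σ k), ← Complex.exp_add, mul_assoc]
    congr 3
    rw [inner_emb, inner_emb]
    push_cast
    ring
  simp only [hFx]
  rw [integral_const_mul, integral_integral_swap hprod]
  congr 2
  ext k
  have : ∀ x : E3, (Yk s ‖x‖ * FTh h σ k) * Complex.exp (-(Complex.I * ((⟪emb σ k, x⟫ : ℝ) : ℂ))) =
      FTh h σ k * (Yk s ‖x‖ * Complex.exp (-(Complex.I * ((⟪emb σ k, x⟫ : ℝ) : ℂ)))) := by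
    intro x; ring
  simp only [this]
  rw [integral_const_mul, Yk_FT s hs, mul_one_div]
  congr 1
  have hn : ‖emb σ k‖ ^ 2 = ‖σ‖ ^ 2 + k ^ 2 := by
    rw [emb_norm, Real.sq_sqrt (by positivity)]
  rw [← Complex.ofReal_pow, hn, hsdef]
  linear_combination ((ω:ℂ)^2 + (ε:ℂ)^2) * Complex.I_sq
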